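/- arXiv:1711.01622 — 2 statements merged into one kernel-verified Lean document; each statement's English description precedes it below -/
import Mathlib

section
/- For every n ≥ 2, the number of EW-tableaux of size n having exactly one 0 in every row other than the top row is the Fibonacci number F_{2n−2}, where F_0 = F_1 = 1 and F_{m} = F_{m−1} + F_{m−2}. More precisely, the number of such tableaux whose top row has length k is the binomial coefficient C(2n−1−k, k−1). -/
/-- A Ferrers diagram (shape): `r` rows; row `i` (for `i < r`) has `len i` cells,
left-aligned, with row lengths weakly decreasing from top to bottom and positive.
`len` is normalized to vanish for `i ≥ r`. -/
structure FerrersShape where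
  r : ℕ
  len : ℕ → ℕ
  r_pos : 0 < r
  anti : ∀ i j, i ≤ j → j < r → len j ≤ len i
  len_pos : ∀ i, i < r → 0 < len i
  len_zero : ∀ i, r ≤ i → len i = 0

/-- An EW-tableau of shape `F` (`one` normalized to `false` outside the diagram). -/
structure EWTableau (F : FerrersShape) where
  one : ℕ → ℕ → Bool
  support : ∀ i j, one i j = true → i < F.r ∧ j < F.len i
  top_row : ∀ j, j < F.len 0 → one 0 j = true
  has_zero : ∀ i, 0 < i → i < F.r → ∃ j, j < F.len i ∧ one i j = false
  no_rect : ∀ i i' j j', i < i' → i' < F.r → j < j' → j' < F.len i' →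
    ¬(one i j = one i' j' ∧ one i j' = one i' j ∧ one i j ≠ one i j')

/-- Head row of a list of rows, with a virtual bottom row `(1,0)`. -/
def hdRow (l : List (ℕ × ℕ)) : ℕ × ℕ := l.headD (1, 0)

/-- Valid lists of rows `(length, position of the zero)`. -/
def okRows : ℕ → List (ℕ × ℕ) → Prop
  | _, [] => True
  | k, p :: t => p.1 ≤ k ∧ p.2 < p.1 ∧ (p.2 = (hdRow t).2 ∨ (hdRow t).1 ≤ p.2) ∧ okRows p.1 t

/-- Weakly decreasing positive lists bounded by `k`. -/
def monL : ℕ → List ℕ → Prop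
  | _, [] => True
  | k, x :: t => 1 ≤ x ∧ x ≤ k ∧ monL x t

def encRows : List (ℕ × ℕ) → List ℕ
  | [] => []
  | p :: t => p.1 :: (if p.2 = (hdRow t).2 then (hdRow t).1 else p.2 + 1) :: encRows t

def decRows : List ℕ → List (ℕ × ℕ)
  | [] => []
  | [_] => []
  | x :: a :: t => (x, if a = (hdRow (decRows t)).1 then (hdRow (decRows t)).2 else a - 1) :: decRows t

def monFin : ℕ → ℕ → Finset (List ℕ)
  | 0, _ => {[]}
  | _ + 1, 0 => ∅
  | p + 1, k + 1 => monFin (p + 1) k ∪ (monFin p (k + 1)).image (List.cons (k + 1))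

theorem mem_monFin (p k : ℕ) (l : List ℕ) : l ∈ monFin p k ↔ l.length = p ∧ monL k l := by
  induction p, k using monFin.induct generalizing l with
  | case1 k => cases l <;> simp [monFin, monL]
  | case2 p =>
    cases l with
    | nil => simp [monFin]
    | cons x t => simp [monFin, monL]; omega
  | case3 p k ih1 ih2 =>
    cases l with
    | nil => simp [monFin, ih1]
    | cons x t =>
      simp only [monFin, Finset.mem_union, ih1, Finset.mem_image, ih2, List.length_cons, monL,
        List.cons.injEq]
      constructor
      · rintro (⟨h1, h2, h3, h4⟩ | ⟨a, ⟨h1, h2⟩, rfl, rfl⟩)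
        · exact ⟨h1, h2, by omega, h4⟩
        · exact ⟨by omega, by omega, le_rfl, h2⟩
      · rintro ⟨h1, h2, h3, h4⟩
        rcases Nat.lt_or_ge k x with h | h
        · obtain rfl : x = k + 1 := by omega
          exact Or.inr ⟨t, ⟨by omega, h4⟩, rfl, rfl⟩
        · exact Or.inl ⟨h1, h2, h, h4⟩

theorem card_monFin (p k : ℕ) : (monFin p k).card = Nat.multichoose k p := by
  induction p, k using monFin.induct with
  | case1 k => simp [monFin]
  | case2 p => simp [monFin]
  | case3 p k ih1 ih2 =>
    rw [monFin, Finset.card_union_of_disjoint, Finset.card_image_of_injective, ih1, ih2,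
      Nat.multichoose_succ_succ]
    · exact List.cons_injective
    · rw [Finset.disjoint_left]
      intro l h h'
      rw [mem_monFin] at h
      rw [Finset.mem_image] at h'
      obtain ⟨a, _, rfl⟩ := h'
      have := h.2.2.1
      omega

theorem hdRow_pos {k : ℕ} {t : List (ℕ × ℕ)} (h : okRows k t) :
    1 ≤ (hdRow t).1 ∧ (hdRow t).2 < (hdRow t).1 ∧ (1 ≤ k → (hdRow t).1 ≤ k) := by
  cases t with
  | nil => simp [hdRow]
  | cons p t =>
    obtain ⟨h1, h2, _⟩ := h
    simp only [hdRow, List.headD_cons]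
    omega

theorem monL_enc (t : List (ℕ × ℕ)) : ∀ k, okRows k t → ∀ k', (hdRow t).1 ≤ k' →
    monL k' (encRows t) := by
  induction t with
  | nil => intros; trivial
  | cons p t ih =>
    rintro k ⟨h1, h2, h3, h4⟩ k' hk
    have hp := hdRow_pos h4
    simp only [hdRow, List.headD_cons] at hk
    refine ⟨by omega, hk, ?_, ?_, ih _ h4 _ ?_⟩
    · split_ifs <;> omega
    · split_ifs <;> omega
    · split_ifs <;> omega

theorem length_enc (t : List (ℕ × ℕ)) : (encRows t).length = 2 * t.length := by
  induction t with
  | nil => rfl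
  | cons p t ih => simp [encRows, ih]; ring

theorem dec_enc (t : List (ℕ × ℕ)) : ∀ k, okRows k t → decRows (encRows t) = t := by
  induction t with
  | nil => intros; rfl
  | cons p t ih =>
    rintro k ⟨h1, h2, h3, h4⟩
    have hp := hdRow_pos h4
    simp only [encRows, decRows, ih _ h4]
    congr 1
    obtain ⟨a, b⟩ := p
    simp only [Prod.mk.injEq, true_and] at *
    split_ifs <;> omega

theorem dec_spec (l : List ℕ) : ∀ m k, l.length = 2 * m → monL k l →
    okRows k (decRows l) ∧ (decRows l).length = m ∧ encRows (decRows l) = l := by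
  induction l using decRows.induct with
  | case1 => intro m k h _; simp [decRows, okRows, encRows] at *; omega
  | case2 => intro m k h _; simp at h; omega
  | case3 x a t ih =>
    rintro m k h ⟨h1, h2, h3, h4, h5⟩
    simp only [List.length_cons] at h
    obtain ⟨i1, i2, i3⟩ := ih (m - 1) a (by omega) h5
    have hp := hdRow_pos i1
    have hle := hp.2.2 h3
    have up : ∀ (s : List (ℕ × ℕ)) a x, a ≤ x → okRows a s → okRows x s := by
      intro s a x hax hs
      cases s with
      | nil => trivial
      | cons p s => exact ⟨hs.1.trans hax, hs.2⟩
    refine ⟨⟨h2, ?_, ?_, up _ _ _ h4 i1⟩, ?_, ?_⟩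
    · simp only; split_ifs <;> omega
    · simp only; split_ifs <;> omega
    · simp only [decRows, List.length_cons]; omega
    · simp only [decRows, encRows, i3]
      congr 2
      split_ifs <;> omega

theorem card_rows (m k : ℕ) :
    Nat.card {l : List (ℕ × ℕ) // l.length = m ∧ okRows (k + 1) l}
      = Nat.multichoose (k + 1) (2 * m) := by
  rw [← card_monFin, ← Fintype.card_coe, ← Nat.card_eq_fintype_card]
  refine Nat.card_congr
    { toFun := fun l => ⟨encRows l.1, (mem_monFin _ _ _).2
        ⟨by rw [length_enc, l.2.1], monL_enc _ _ l.2.2 _ ((hdRow_pos l.2.2).2.2 (by omega))⟩⟩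
      invFun := fun l => ⟨decRows l.1, ?_⟩
      left_inv := fun l => Subtype.ext (dec_enc _ _ l.2.2)
      right_inv := fun l => Subtype.ext ?_ }
  · have h := (mem_monFin _ _ _).1 l.2
    have := dec_spec _ _ _ h.1 h.2
    exact ⟨this.2.1, this.1⟩
  · have h := (mem_monFin _ _ _).1 l.2
    exact (dec_spec _ _ _ h.1 h.2).2.2

theorem okRows_iff (l : List (ℕ × ℕ)) : ∀ k, okRows k l ↔ (∀ p ∈ l, p.1 ≤ k ∧ p.2 < p.1) ∧
    l.Pairwise (fun p q => q.1 ≤ p.1 ∧ (p.2 = q.2 ∨ q.1 ≤ p.2)) := by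
  induction l with
  | nil => simp [okRows]
  | cons p t ih =>
    intro k
    simp only [okRows, ih, List.mem_cons, forall_eq_or_imp, List.pairwise_cons]
    constructor
    · rintro ⟨h1, h2, h3, h4, h5⟩
      refine ⟨⟨⟨h1, h2⟩, fun q hq => ⟨(h4 q hq).1.trans h1, (h4 q hq).2⟩⟩,
        fun q hq => ⟨(h4 q hq).1, ?_⟩, h5⟩
      cases t with
      | nil => simp at hq
      | cons u t =>
        simp only [hdRow, List.headD_cons] at h3
        rw [List.pairwise_cons] at h5
        rcases List.mem_cons.1 hq with rfl | hq
        · exact h3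
        · have := h5.1 q hq
          omega
    · rintro ⟨⟨⟨h1, h2⟩, h3⟩, h4, h5⟩
      refine ⟨h1, h2, ?_, fun q hq => ⟨(h4 q hq).1, (h3 q hq).2⟩, h5⟩
      cases t with
      | nil => simp [hdRow]; omega
      | cons u t => exact (h4 u (by simp)).2

/-- Row length function of a list of rows. -/
def lenOf (k : ℕ) (l : List (ℕ × ℕ)) : ℕ → ℕ
  | 0 => k
  | i + 1 => (l.getD i (0, 0)).1

def oneOf (k : ℕ) (l : List (ℕ × ℕ)) : ℕ → ℕ → Bool
  | 0, j => decide (j < k)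
  | i + 1, j => decide (j < (l.getD i (0, 0)).1 ∧ j ≠ (l.getD i (0, 0)).2)

theorem ok_get {k : ℕ} {l : List (ℕ × ℕ)} (h : okRows k l) {i : ℕ} (hi : i < l.length) :
    (l.getD i (0, 0)).1 ≤ k ∧ (l.getD i (0, 0)).2 < (l.getD i (0, 0)).1 := by
  rw [List.getD_eq_getElem _ _ hi]
  exact ((okRows_iff l k).1 h).1 _ (List.getElem_mem hi)

theorem ok_get2 {k : ℕ} {l : List (ℕ × ℕ)} (h : okRows k l) {i j : ℕ} (hij : i < j)
    (hj : j < l.length) :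
    (l.getD j (0, 0)).1 ≤ (l.getD i (0, 0)).1 ∧
    ((l.getD i (0, 0)).2 = (l.getD j (0, 0)).2 ∨ (l.getD j (0, 0)).1 ≤ (l.getD i (0, 0)).2) := by
  rw [List.getD_eq_getElem _ _ hj, List.getD_eq_getElem _ _ (hij.trans hj)]
  exact List.pairwise_iff_getElem.1 ((okRows_iff l k).1 h).2 i j _ _ hij

def shapeOf (k : ℕ) (hk : 1 ≤ k) (l : List (ℕ × ℕ)) (h : okRows k l) : FerrersShape where
  r := l.length + 1
  len := lenOf k l
  r_pos := by omega
  anti := by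
    intro i j hij hj
    rcases i with _ | i <;> rcases j with _ | j
    · exact le_rfl
    · exact (ok_get h (by omega)).1
    · omega
    · rcases Nat.lt_or_ge i j with h' | h'
      · exact (ok_get2 h h' (by omega)).1
      · obtain rfl : i = j := by omega
        exact le_rfl
  len_pos := by
    intro i hi
    rcases i with _ | i
    · exact hk
    · have := ok_get h (i := i) (by omega)
      simp only [lenOf]
      omega
  len_zero := by
    intro i hi
    rcases i with _ | i
    · omega
    · simp only [lenOf]
      rw [List.getD_eq_default _ _ (by omega)]

def tabOf (k : ℕ) (hk : 1 ≤ k) (l : List (ℕ × ℕ)) (h : okRows k l) :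
    EWTableau (shapeOf k hk l h) where
  one := oneOf k l
  support := by
    intro i j hij
    rcases i with _ | i
    · simp only [oneOf, decide_eq_true_eq] at hij
      exact ⟨by simp [shapeOf], hij⟩
    · simp only [oneOf, decide_eq_true_eq] at hij
      refine ⟨?_, hij.1⟩
      by_contra hc
      simp only [shapeOf] at hc
      rw [List.getD_eq_default _ _ (by omega)] at hij
      simp at hij
  top_row := by
    intro j hj
    exact decide_eq_true (show j < k from hj)
  has_zero := by
    intro i hi hr
    rcases i with _ | i
    · omega
    · simp only [shapeOf] at hr
      exact ⟨_, (ok_get h (i := i) (by omega)).2, by simp [oneOf]⟩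
  no_rect := by
    intro i i' j j' hi hr hj hj'
    rcases i' with _ | i'
    · omega
    · simp only [shapeOf, lenOf] at hr hj'
      rcases i with _ | i
      · have := (ok_get h (i := i') (by omega)).1
        have h1 : j < k := by omega
        have h2 : j' < k := by omega
        simp [oneOf, h1, h2]
      · have := ok_get2 h (i := i) (j := i') (by omega) (by omega)
        simp only [oneOf]
        generalize l.getD i (0, 0) = p at *
        generalize l.getD i' (0, 0) = q at *
        rintro ⟨e1, e2, e3⟩
        have g1 : j < p.1 := by omega
        have g2 : j' < p.1 := by omega
        have g3 : j < q.1 := by omega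
        grind

theorem sigma_ext (S T : Σ F : FerrersShape, EWTableau F) (h1 : S.1.r = T.1.r)
    (h2 : S.1.len = T.1.len) (h3 : S.2.one = T.2.one) : S = T := by
  obtain ⟨⟨r, len, _, _, _, _⟩, ⟨one, _, _, _, _⟩⟩ := S
  obtain ⟨⟨r', len', _, _, _, _⟩, ⟨one', _, _, _, _⟩⟩ := T
  dsimp only at h1 h2 h3
  subst h1 h2 h3
  rfl

/-- The tableaux with `m + 1` rows and top row of length `k`. -/
def goodT (m k : ℕ) (T : Σ F : FerrersShape, EWTableau F) : Prop :=
  T.1.r = m + 1 ∧ T.1.len 0 = k ∧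
    ∀ i, 0 < i → i < T.1.r → ∃! j, j < T.1.len i ∧ T.2.one i j = false

def toT (m k : ℕ) (hk : 1 ≤ k) (l : {l : List (ℕ × ℕ) // l.length = m ∧ okRows k l}) :
    {T // goodT m k T} :=
  ⟨⟨shapeOf k hk l.1 l.2.2, tabOf k hk l.1 l.2.2⟩, by
    refine ⟨by simp [shapeOf, l.2.1], rfl, ?_⟩
    intro i hi hr
    rcases i with _ | i
    · omega
    · simp only [shapeOf] at hr
      refine ⟨_, ⟨(ok_get l.2.2 (i := i) (by omega)).2, by simp [tabOf, oneOf]⟩, ?_⟩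
      rintro j ⟨h1, h2⟩
      simp only [shapeOf, lenOf] at h1
      simp only [tabOf, oneOf, decide_eq_false_iff_not, not_and, not_not] at h2
      exact h2 h1⟩

theorem toT_bij (m k : ℕ) (hk : 1 ≤ k) : Function.Bijective (toT m k hk) := by
  constructor
  · rintro ⟨l, hl, ho⟩ ⟨l', hl', ho'⟩ h
    have h0 := congrArg Subtype.val h
    have h1 : lenOf k l = lenOf k l' := congrArg (fun T => T.1.len) h0
    have h2 : oneOf k l = oneOf k l' :=
      congrArg (fun T : Σ F : FerrersShape, EWTableau F => T.2.one) h0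
    apply Subtype.ext
    apply List.ext_getElem (by simp [hl, hl'])
    intro i hi hi'
    have a1 := congrFun h1 (i + 1)
    have a2 := congrFun (congrFun h2 (i + 1)) (l.getD i (0, 0)).2
    have a3 := (ok_get ho hi).2
    simp only at hi hi'
    simp only [lenOf, oneOf] at a1 a2
    rw [List.getD_eq_getElem _ _ hi] at *
    rw [List.getD_eq_getElem _ _ hi'] at *
    apply Prod.ext a1
    simp only [ne_eq, not_true_eq_false, and_false, decide_false] at a2
    have a4 := of_decide_eq_false a2.symm
    by_contra hc
    exact a4 ⟨by omega, hc⟩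
  · rintro ⟨⟨F, T⟩, hr, hk', hu⟩
    dsimp only at hr hk' hu
    have hz : ∀ i, ∃ z, i < m → z < F.len (i + 1) ∧ ∀ j, j < F.len (i + 1) →
        (T.one (i + 1) j = false ↔ j = z) := by
      intro i
      by_cases hi : i < m
      · obtain ⟨z, ⟨h1, h2⟩, h3⟩ := hu (i + 1) (by omega) (by omega)
        exact ⟨z, fun _ => ⟨h1, fun j hj => ⟨fun h => h3 j ⟨hj, h⟩, fun h => h ▸ h2⟩⟩⟩
      · exact ⟨0, fun h => absurd h hi⟩
    choose z hz using hz
    have hok : okRows k ((List.range m).map fun i => (F.len (i + 1), z i)) := by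
      rw [okRows_iff]
      constructor
      · intro p hp
        simp only [List.mem_map, List.mem_range] at hp
        obtain ⟨i, hi, rfl⟩ := hp
        exact ⟨hk' ▸ F.anti 0 (i + 1) (by omega) (by omega), (hz i hi).1⟩
      · rw [List.pairwise_iff_getElem]
        intro i j hi hj hij
        simp only [List.length_map, List.length_range] at hi hj
        simp only [List.getElem_map, List.getElem_range]
        have hlen := F.anti (i + 1) (j + 1) (by omega) (by omega)
        refine ⟨hlen, ?_⟩
        by_contra! hc
        obtain ⟨b1, b2⟩ := hz i hi
        obtain ⟨c1, c2⟩ := hz j hj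
        have e1 := (b2 (z i) b1).2 rfl
        have e2 := (c2 (z j) c1).2 rfl
        have e3 : T.one (i + 1) (z j) = true := by
          rw [← Bool.not_eq_false, b2 _ (by omega)]; exact fun h => hc.1 h.symm
        have e4 : T.one (j + 1) (z i) = true := by
          rw [← Bool.not_eq_false, c2 _ (by omega)]; exact hc.1
        rcases Nat.lt_or_gt_of_ne hc.1 with h | h
        · exact T.no_rect (i + 1) (j + 1) (z i) (z j) (by omega) (by omega) h c1
            (by simp [e1, e2, e3, e4])
        · exact T.no_rect (i + 1) (j + 1) (z j) (z i) (by omega) (by omega) h hc.2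
            (by simp [e1, e2, e3, e4])
    refine ⟨⟨_, by simp, hok⟩, ?_⟩
    apply Subtype.ext
    have hlenE : ∀ i, (((List.range m).map fun i => (F.len (i + 1), z i)).getD i (0, 0)).1
        = F.len (i + 1) := by
      intro i
      by_cases hi : i < m
      · rw [List.getD_eq_getElem _ _ (by simpa using hi)]; simp
      · rw [List.getD_eq_default _ _ (by simpa using hi), F.len_zero _ (by omega)]
    apply sigma_ext
    · simp [toT, shapeOf, hr]
    · funext i
      rcases i with _ | i
      · exact hk'.symm
      · exact hlenE i
    · funext i j
      rcases i with _ | i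
      · simp only [toT, tabOf, oneOf]
        by_cases hj : j < k
        · rw [T.top_row j (by omega)]; simpa using hj
        · have : ¬ T.one 0 j = true := fun h => hj (hk' ▸ (T.support 0 j h).2)
          simp only [Bool.not_eq_true] at this
          rw [this]; simpa using hj
      · simp only [toT, tabOf, oneOf]
        rw [hlenE]
        by_cases hj : j < F.len (i + 1)
        · have hi : i < m := by
            by_contra hc
            rw [F.len_zero _ (by omega)] at hj
            omega
          rw [List.getD_eq_getElem _ _ (by simpa using hi)]
          have := (hz i hi).2 j hj
          simp only [List.getElem_map, List.getElem_range, hj, true_and]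
          by_cases hjz : j = z i
          · simp [hjz] at this ⊢; simp [this]
          · simp [hjz] at this ⊢; simp [this]
        · have : ¬ T.one (i + 1) j = true := fun h => hj (T.support _ j h).2
          simp only [Bool.not_eq_true] at this
          rw [this]; simp [hj]

theorem card_goodT (m k : ℕ) :
    Nat.card {T // goodT m (k + 1) T} = Nat.choose (2 * m + k) k := by
  rw [← Nat.card_eq_of_bijective _ (toT_bij m (k + 1) (by omega)), card_rows,
    Nat.multichoose_eq]
  have : k + 1 + 2 * m - 1 = 2 * m + k := by omega
  rw [this, Nat.choose_symm_add]

theorem card_fixed (n k : ℕ) (hn : 2 ≤ n) (hk : 1 ≤ k) :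
    Nat.card {T : Σ F : FerrersShape, EWTableau F //
          T.1.r + T.1.len 0 = n + 1 ∧ T.1.len 0 = k ∧
          ∀ i, 0 < i → i < T.1.r → ∃! j, j < T.1.len i ∧ T.2.one i j = false}
        = Nat.choose (2 * n - 1 - k) (k - 1) := by
  rcases Nat.lt_or_ge n k with h | h
  · rw [Nat.choose_eq_zero_of_lt (by omega)]
    have : IsEmpty {T : Σ F : FerrersShape, EWTableau F //
          T.1.r + T.1.len 0 = n + 1 ∧ T.1.len 0 = k ∧
          ∀ i, 0 < i → i < T.1.r → ∃! j, j < T.1.len i ∧ T.2.one i j = false} := by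
      refine ⟨fun T => ?_⟩
      have := T.1.1.r_pos
      have := T.2.1
      have := T.2.2.1
      omega
    exact Nat.card_of_isEmpty
  · obtain ⟨k, rfl⟩ : ∃ j, k = j + 1 := ⟨k - 1, by omega⟩
    have e := card_goodT (n - (k + 1)) k
    have h1 : 2 * (n - (k + 1)) + k = 2 * n - 1 - (k + 1) := by omega
    rw [h1] at e
    rw [Nat.add_sub_cancel, ← e]
    apply Nat.card_congr
    apply Equiv.subtypeEquivRight
    intro T
    unfold goodT
    constructor
    · rintro ⟨a, b, c⟩
      exact ⟨by omega, b, c⟩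
    · rintro ⟨a, b, c⟩
      exact ⟨by omega, b, c⟩

/-- for `n ≥ 2` the number of EW-tableaux of size `n` with exactly
one 0 in every non-top row is the Fibonacci number `F_{2n-2}` (where
`F_0 = F_1 = 1`, so `F_{2n-2} = Nat.fib (2n-1)`); more precisely, the number of
such tableaux whose top row has length `k ≥ 1` is `C(2n-1-k, k-1)`. -/
theorem ewTableaux_one_zero_per_row_fibonacci (n : ℕ) (hn : 2 ≤ n) :
    (Nat.card {T : Σ F : FerrersShape, EWTableau F //
        T.1.r + T.1.len 0 = n + 1 ∧
        ∀ i, 0 < i → i < T.1.r → ∃! j, j < T.1.len i ∧ T.2.one i j = false}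
      = Nat.fib (2 * n - 1)) ∧
    ∀ k, 1 ≤ k →
      Nat.card {T : Σ F : FerrersShape, EWTableau F //
          T.1.r + T.1.len 0 = n + 1 ∧ T.1.len 0 = k ∧
          ∀ i, 0 < i → i < T.1.r → ∃! j, j < T.1.len i ∧ T.2.one i j = false}
        = Nat.choose (2 * n - 1 - k) (k - 1) := by
  refine ⟨?_, fun k hk => card_fixed n k hn hk⟩
  set P : (Σ F : FerrersShape, EWTableau F) → Prop := fun T => T.1.r + T.1.len 0 = n + 1 ∧
        ∀ i, 0 < i → i < T.1.r → ∃! j, j < T.1.len i ∧ T.2.one i j = false with hP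
  change Nat.card {T // P T} = _
  have hlt : ∀ T : {T // P T}, T.1.1.len 0 - 1 < n := by
    intro T
    have := T.2.1
    have := T.1.1.r_pos
    omega
  let f : {T // P T} → Fin n := fun T => ⟨T.1.1.len 0 - 1, hlt T⟩
  have hf : ∀ k : Fin n, Nat.card {T // f T = k} = Nat.choose (2 * n - 2 - k) k := by
    intro k
    have e := card_fixed n (k + 1) hn (by omega)
    have h1 : 2 * n - 1 - (k + 1) = 2 * n - 2 - k := by omega
    rw [h1, Nat.add_sub_cancel] at e
    rw [← e]
    refine Nat.card_congr ((Equiv.subtypeSubtypeEquivSubtypeExists P (fun T => f T = k)).trans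
      (Equiv.subtypeEquivRight ?_))
    intro T
    have hp := T.1.len_pos 0 T.1.r_pos
    constructor
    · rintro ⟨a, b⟩
      have b' : T.1.len 0 - 1 = k := congrArg Fin.val b
      exact ⟨a.1, by omega, a.2⟩
    · rintro ⟨a, b, c⟩
      exact ⟨⟨a, c⟩, Fin.ext (show T.1.len 0 - 1 = k by omega)⟩
  have hfin : ∀ k : Fin n, Finite {T // f T = k} := by
    intro k
    apply Nat.finite_of_card_ne_zero
    rw [hf]
    exact (Nat.choose_pos (by omega)).ne'
  rw [Nat.card_congr (Equiv.sigmaFiberEquiv f).symm, Nat.card_sigma]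
  simp only [hf]
  rw [Fin.sum_univ_eq_sum_range (fun k => Nat.choose (2 * n - 2 - k) k) n]
  have h2 : 2 * n - 1 = (2 * n - 2) + 1 := by omega
  rw [h2, Nat.fib_succ_eq_sum_choose, ← Finset.Nat.sum_antidiagonal_swap,
    Finset.Nat.sum_antidiagonal_eq_sum_range_succ_mk]
  apply Finset.sum_subset
  · intro x hx
    simp only [Finset.mem_range] at *
    omega
  · intro x _ hx
    simp only [Finset.mem_range] at hx
    exact Nat.choose_eq_zero_of_lt (by omega)
end

section
/- Let π be an n-permutation that avoids the pattern 231, and let T(π) be the corresponding EW-tableau. If T(π) has at least two rows, then the second row of T(π) contains exactly one 0. -/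
/-- The label of row `i` in the southeast-border labeling `0,1,…,n`. -/
def rowLabel (F : FerrersShape) (i : ℕ) : ℕ := i + (F.len 0 - F.len i)

/-- The label of column `j` in the southeast-border labeling `0,1,…,n`. -/
def colLabel (F : FerrersShape) (j : ℕ) : ℕ :=
  (F.len 0 - 1 - j) + ((Finset.range F.r).filter (fun i => j < F.len i)).card

/-- An `n`-permutation, encoded as a map `a : ℕ → ℕ` permuting `{1,…,n}`
(normalized to `0` off `{1,…,n}`); `a i` is the letter in place `i`. -/
def IsPermOn (n : ℕ) (a : ℕ → ℕ) : Prop :=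
  Set.BijOn a (Set.Icc 1 n) (Set.Icc 1 n) ∧ ∀ i, i ∉ Set.Icc 1 n → a i = 0

/-- The descent bottoms set of an `n`-permutation: `{a_{i+1} : a_i > a_{i+1}}`. -/
def DescBottoms (n : ℕ) (a : ℕ → ℕ) : Set ℕ :=
  {b | ∃ i, 1 ≤ i ∧ i < n ∧ a (i + 1) < a i ∧ a (i + 1) = b}

/-- `x` precedes `y` in the word `0π` (note `a 0 = 0`). -/
def Prec (n : ℕ) (a : ℕ → ℕ) (x y : ℕ) : Prop :=
  ∃ p q, p < q ∧ q ≤ n ∧ a p = x ∧ a q = y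

/-- If column `j` meets row `i`, its label exceeds that of row `i`. -/
theorem colLabel_gt (F : FerrersShape) (i j : ℕ) (hi : i < F.r) (hj : j < F.len i) :
    rowLabel F i < colLabel F j := by
  have h1 : (Finset.range (i + 1)) ⊆ (Finset.range F.r).filter (fun i => j < F.len i) := by
    intro x hx
    simp only [Finset.mem_range, Finset.mem_filter] at *
    exact ⟨by omega, lt_of_lt_of_le hj (F.anti x i (by omega) hi)⟩
  have h2 := Finset.card_le_card h1
  have h3 := F.anti 0 i (by omega) hi
  rw [Finset.card_range] at h2
  unfold rowLabel colLabel
  omega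

/-- If column `j` does not meet row `i`, its label is below that of row `i`. -/
theorem colLabel_lt (F : FerrersShape) (i j : ℕ) (hi : i < F.r) (hj : F.len i ≤ j)
    (hj0 : j < F.len 0) : colLabel F j < rowLabel F i := by
  have h1 : (Finset.range F.r).filter (fun i => j < F.len i) ⊆ Finset.range i := by
    intro x hx
    simp only [Finset.mem_range, Finset.mem_filter] at *
    by_contra hlt
    have := F.anti i x (by omega) hx.1
    omega
  have h2 := Finset.card_le_card h1
  rw [Finset.card_range] at h2
  unfold rowLabel colLabel
  omega

theorem colLabel_anti (F : FerrersShape) (j j' : ℕ) (h : j < j') (hj : j' < F.len 0) :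
    colLabel F j' < colLabel F j := by
  have h1 : (Finset.range F.r).filter (fun i => j' < F.len i) ⊆
      (Finset.range F.r).filter (fun i => j < F.len i) := by
    intro x hx
    simp only [Finset.mem_range, Finset.mem_filter] at *
    exact ⟨hx.1, by omega⟩
  have h2 := Finset.card_le_card h1
  unfold colLabel
  omega

theorem colLabel_le (F : FerrersShape) (j : ℕ) :
    colLabel F j ≤ F.len 0 - 1 + F.r := by
  have h2 := Finset.card_filter_le (Finset.range F.r) (fun i => j < F.len i)
  rw [Finset.card_range] at h2
  unfold colLabel
  omega

/-- Core argument: two non-descent-bottoms above the least descent bottom cannot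
both precede it in a 231-avoiding permutation. -/
theorem core231 (n : ℕ) (a : ℕ → ℕ) (ha : IsPermOn n a)
    (havoid : ¬∃ i j k, 1 ≤ i ∧ i < j ∧ j < k ∧ k ≤ n ∧ a k < a i ∧ a i < a j)
    (m : ℕ) (hmin : ∀ b ∈ DescBottoms n a, m ≤ b)
    (p q s : ℕ) (hp : 1 ≤ p) (hq : 1 ≤ q) (hs : s ≤ n) (hps : p < s) (hqs : q < s)
    (hsm : a s = m) (hmc : m < a p) (hcd : a p < a q) (hc : a p ∉ DescBottoms n a) :
    False := by
  have hpq : p ≠ q := by rintro rfl; omega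
  rcases lt_or_gt_of_ne hpq with h | h
  · exact havoid ⟨p, q, s, hp, h, hqs, hs, by omega, hcd⟩
  -- every letter from place `q` up to `p` is at least `m`
  have key : ∀ k, q + k ≤ n → m ≤ a (q + k) := by
    intro k
    induction k with
    | zero => intro _; simp only [add_zero]; omega
    | succ k ih =>
      intro hk
      have h1 := ih (by omega)
      by_contra hlt
      have := hmin (a (q + k + 1)) ⟨q + k, by omega, by omega, by
        rw [← add_assoc] at hlt; omega, rfl⟩
      rw [← add_assoc] at hlt
      omega
  obtain ⟨e, rfl⟩ : ∃ e, p = e + 1 := ⟨p - 1, by omega⟩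
  have he := key (e - q) (by omega)
  rw [show q + (e - q) = e by omega] at he
  have hne : a e ≠ m := by
    intro h'
    have := ha.1.injOn (show e ∈ Set.Icc 1 n from ⟨by omega, by omega⟩)
      (show s ∈ Set.Icc 1 n from ⟨by omega, hs⟩) (by rw [h', hsm])
    omega
  have hne2 : a e ≠ a (e + 1) := by
    intro h'
    have := ha.1.injOn (show e ∈ Set.Icc 1 n from ⟨by omega, by omega⟩)
      (show e + 1 ∈ Set.Icc 1 n from ⟨by omega, by omega⟩) h'
    omega
  have hle : a e ≤ a (e + 1) := by
    by_contra hlt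
    exact hc ⟨e, by omega, by omega, by omega, rfl⟩
  exact havoid ⟨e, e + 1, s, by omega, by omega, hps, hs, by omega, by omega⟩

/-- let `π` be an `n`-permutation avoiding the pattern 231 and
`T(π)` the corresponding EW-tableau (its row labels are `0` together with the
descent bottoms of `π`, and a cell in row `r`, column `c` holds a 1 iff `r`
precedes `c` in `0π`).  If `T(π)` has at least two rows, then its second row
contains exactly one 0. -/
theorem avoid231_second_row_unique_zero (n : ℕ) (hn : 0 < n)
    (a : ℕ → ℕ) (ha : IsPermOn n a)
    (havoid : ¬∃ i j k, 1 ≤ i ∧ i < j ∧ j < k ∧ k ≤ n ∧ a k < a i ∧ a i < a j)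
    (F : FerrersShape) (T : EWTableau F) (hsize : F.r + F.len 0 = n + 1)
    (hrows : DescBottoms n a = {x | ∃ i, 0 < i ∧ i < F.r ∧ rowLabel F i = x})
    (hfill : ∀ i j, i < F.r → j < F.len i →
      (T.one i j = true ↔ Prec n a (rowLabel F i) (colLabel F j)))
    (htwo : 2 ≤ F.r) :
    ∃! j, j < F.len 1 ∧ T.one 1 j = false := by
  have hrow_mono : ∀ i, 0 < i → i < F.r → rowLabel F 1 ≤ rowLabel F i := by
    intro i h0 hi
    have h1 := F.anti 1 i h0 hi
    unfold rowLabel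
    omega
  have h10 : F.len 1 ≤ F.len 0 := F.anti 0 1 (by omega) (by omega)
  have hmin : ∀ b ∈ DescBottoms n a, rowLabel F 1 ≤ b := by
    intro b hb
    rw [hrows] at hb
    obtain ⟨i, h0, hi, rfl⟩ := hb
    exact hrow_mono i h0 hi
  have hm : rowLabel F 1 ∈ DescBottoms n a := by
    rw [hrows]
    exact ⟨1, by omega, by omega, rfl⟩
  obtain ⟨s', hs1, hs2, -, hsm⟩ := hm
  have hcol : ∀ j, j < F.len 0 → colLabel F j ∉ DescBottoms n a := by
    intro j hj hb
    rw [hrows] at hb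
    obtain ⟨i, h0, hi, hEq⟩ := hb
    rcases lt_or_ge j (F.len i) with h | h
    · have := colLabel_gt F i j hi h
      omega
    · have := colLabel_lt F i j hi h hj
      omega
  -- a zero in row 1 gives a place before that of the row label
  have hpos : ∀ j, j < F.len 1 → T.one 1 j = false →
      ∃ p, 1 ≤ p ∧ p < s' + 1 ∧ a p = colLabel F j := by
    intro j hj hf
    have hgt := colLabel_gt F 1 j (by omega) hj
    have hle := colLabel_le F j
    obtain ⟨p, ⟨hp1, hp2⟩, hp⟩ := ha.1.surjOn
      (show colLabel F j ∈ Set.Icc 1 n from ⟨by omega, by omega⟩)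
    refine ⟨p, hp1, ?_, hp⟩
    by_contra hlt
    have hne : p ≠ s' + 1 := by
      rintro rfl
      omega
    have := (hfill 1 j (by omega) hj).2 ⟨s' + 1, p, by omega, hp2, hsm, hp⟩
    rw [hf] at this
    exact Bool.noConfusion this
  have main : ∀ j j', j < j' → j' < F.len 1 → T.one 1 j = false →
      T.one 1 j' = false → False := by
    intro j j' hlt hj' hf hf'
    obtain ⟨q, hq1, hqs, hq⟩ := hpos j (by omega) hf
    obtain ⟨p, hp1, hps, hp⟩ := hpos j' hj' hf'
    have hgt := colLabel_gt F 1 j' (by omega) hj'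
    have hanti := colLabel_anti F j j' hlt (by omega)
    exact core231 n a ha havoid (rowLabel F 1) hmin p q (s' + 1) hp1 hq1 (by omega) hps hqs
      hsm (by omega) (by omega) (by rw [hp]; exact hcol j' (by omega))
  obtain ⟨j, hj, hf⟩ := T.has_zero 1 (by omega) (by omega)
  refine ⟨j, ⟨hj, hf⟩, ?_⟩
  rintro y ⟨hy, hyf⟩
  rcases lt_trichotomy y j with h | h | h
  · exact (main y j h hj hyf hf).elim
  · exact h
  · exact (main j y h hy hf hyf).elim
end
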